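/- arXiv:1807.01184 — 2 statements merged into one kernel-verified Lean document; each statement's English description precedes it below -/
import Mathlib

section
/- Let $0<p_1\le u_1<\infty$ and $0<p_2\le u_2<\infty$. Then $m_{u_1,p_1}(\mathbb{Z}^d)\subset m_{u_2,p_2}(\mathbb{Z}^d)$ with a continuous embedding (i.e. there is $C>0$ with $\|\lambda\,|\,m_{u_2,p_2}\|\le C\,\|\lambda\,|\,m_{u_1,p_1}\|$ for all $\lambda\in m_{u_1,p_1}$) if, and only if, $u_1\le u_2$ and $p_2/u_2\le p_1/u_1$. -/
open scoped ENNReal NNReal BigOperators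
open Filter

/-- The unit cube `Q_{0,k}` is contained in the dyadic cube `Q_{-j,m}` of side length `2^j`. -/
def inDyadic (d j : ℕ) (m k : Fin d → ℤ) : Prop :=
  ∀ i, 2 ^ j * m i ≤ k i ∧ k i < 2 ^ j * (m i + 1)

/-- The Morrey sequence space quasi-norm `‖λ | m_{u,p}(ℤ^d)‖`, with values in `ℝ≥0∞`. -/
noncomputable def morreyNorm (d : ℕ) (u p : ℝ) (lam : (Fin d → ℤ) → ℂ) : ℝ≥0∞ :=
  ⨆ (j : ℕ) (m : Fin d → ℤ),
    ((2 : ℝ≥0∞) ^ (j * d)) ^ (1 / u - 1 / p) *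
      (∑' k : {k : Fin d → ℤ // inDyadic d j m k}, (‖lam k.1‖₊ : ℝ≥0∞) ^ p) ^ (1 / p)

/-- The `ℓ_r(ℤ^d)` norm. -/
noncomputable def lpNorm (d : ℕ) (r : ℝ) (lam : (Fin d → ℤ) → ℂ) : ℝ≥0∞ :=
  (∑' k : Fin d → ℤ, (‖lam k‖₊ : ℝ≥0∞) ^ r) ^ (1 / r)

/-- The `ℓ_∞(ℤ^d)` norm. -/
noncomputable def lInftyNorm (d : ℕ) (lam : (Fin d → ℤ) → ℂ) : ℝ≥0∞ :=
  ⨆ k : Fin d → ℤ, (‖lam k‖₊ : ℝ≥0∞)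

/-- The weak Lorentz `ℓ_{u,∞}(ℤ^d)` norm, via the distribution function. -/
noncomputable def weakNorm (d : ℕ) (u : ℝ) (lam : (Fin d → ℤ) → ℂ) : ℝ≥0∞ :=
  ⨆ t : ℝ≥0, (t : ℝ≥0∞) *
    (∑' _ : {k : Fin d → ℤ // (t : ℝ) < ‖lam k‖}, (1 : ℝ≥0∞)) ^ (1 / u)

/-- The norm of the level-`j` space `X^{(j)}_{u,p}(ℤ^d)`. -/
noncomputable def XjNorm (d : ℕ) (u p p' : ℝ) (j : ℕ) (lam : (Fin d → ℤ) → ℂ) : ℝ≥0∞ :=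
  ((2 : ℝ≥0∞) ^ (j * d)) ^ (1 / p - 1 / u) *
    ∑' m : Fin d → ℤ,
      (∑' k : {k : Fin d → ℤ // inDyadic d j m k}, (‖lam k.1‖₊ : ℝ≥0∞) ^ p') ^ (1 / p')

/-- The norm of `X_{u,p}(ℤ^d)`: infimum over decompositions `λ = ∑_j λ^{(j)}`. -/
noncomputable def XupNorm (d : ℕ) (u p p' : ℝ) (lam : (Fin d → ℤ) → ℂ) : ℝ≥0∞ :=
  ⨅ (L : ℕ → (Fin d → ℤ) → ℂ) (_ : ∀ k, HasSum (fun j => L j k) (lam k)),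
    ∑' j : ℕ, XjNorm d u p p' j (L j)

/-- Membership in `m_{u,p}(ℤ^d)`. -/
def MemMorrey (d : ℕ) (u p : ℝ) (lam : (Fin d → ℤ) → ℂ) : Prop :=
  morreyNorm d u p lam ≠ ⊤

/-- Membership in `m^{00}_{u,p}(ℤ^d)`, the closure of the finitely supported sequences. -/
def MemMorrey00 (d : ℕ) (u p : ℝ) (lam : (Fin d → ℤ) → ℂ) : Prop :=
  MemMorrey d u p lam ∧
    ∀ ε : ℝ≥0∞, 0 < ε → ∃ mu : (Fin d → ℤ) → ℂ,
      (Function.support mu).Finite ∧ morreyNorm d u p (lam - mu) < ε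

/-- `Q_{-ν,m} ⊆ Q_{-j,0}` for dyadic cubes. -/
def subCube (d j ν : ℕ) (m : Fin d → ℤ) : Prop :=
  ν ≤ j ∧ ∀ i, 0 ≤ m i ∧ 2 ^ ν * (m i + 1) ≤ 2 ^ j

/-- Norm of the finite-dimensional Morrey space `m^{2^{jd}}_{u,p}` on the cube `Q_{-j,0}`. -/
noncomputable def finMorreyNorm (d : ℕ) (u p : ℝ) (j : ℕ) (lam : (Fin d → ℤ) → ℂ) : ℝ≥0∞ :=
  ⨆ (ν : ℕ) (m : Fin d → ℤ) (_ : subCube d j ν m),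
    ((2 : ℝ≥0∞) ^ (ν * d)) ^ (1 / u - 1 / p) *
      (∑' k : {k : Fin d → ℤ // inDyadic d ν m k}, (‖lam k.1‖₊ : ℝ≥0∞) ^ p) ^ (1 / p)

/-- Operator norm of `id_j : m^{2^{jd}}_{u₁,p₁} → m^{2^{jd}}_{u₂,p₂}`. -/
noncomputable def morreyOpNorm (d : ℕ) (u₁ p₁ u₂ p₂ : ℝ) (j : ℕ) : ℝ≥0∞ :=
  ⨆ (lam : (Fin d → ℤ) → ℂ) (_ : finMorreyNorm d u₁ p₁ j lam ≤ 1),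
    finMorreyNorm d u₂ p₂ j lam

/-! ### Dyadic cubes as finsets -/

/-- The unit cubes in a dyadic cube, as a finset. -/
noncomputable def dyCube (d j : ℕ) (m : Fin d → ℤ) : Finset (Fin d → ℤ) :=
  Fintype.piFinset fun i => Finset.Ico (2 ^ j * m i) (2 ^ j * (m i + 1))

lemma mem_dyCube (d j : ℕ) (m k : Fin d → ℤ) : k ∈ dyCube d j m ↔ inDyadic d j m k := by
  simp [dyCube, inDyadic]

lemma card_dyCube (d j : ℕ) (m : Fin d → ℤ) : (dyCube d j m).card = 2 ^ (j * d) := by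
  rw [dyCube, Fintype.card_piFinset]
  have : ∀ i, (Finset.Ico (2 ^ j * m i) (2 ^ j * (m i + 1))).card = 2 ^ j := by
    intro i
    rw [Int.card_Ico]
    have : (2 : ℤ) ^ j * (m i + 1) - 2 ^ j * m i = ((2 ^ j : ℕ) : ℤ) := by push_cast; ring
    rw [this, Int.toNat_natCast]
  simp [this, pow_mul]

lemma tsum_dyadic (d j : ℕ) (m : Fin d → ℤ) (f : (Fin d → ℤ) → ℝ≥0∞) :
    ∑' k : {k : Fin d → ℤ // inDyadic d j m k}, f k.1 = ∑ k ∈ dyCube d j m, f k := by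
  rw [← Finset.tsum_subtype]
  exact (Equiv.subtypeEquivRight fun k => (mem_dyCube d j m k).symm).tsum_eq
    (fun k : {k // k ∈ dyCube d j m} => f k.1)

lemma two_pow_rpow (a : ℕ) (x : ℝ) : ((2 : ℝ≥0∞) ^ a) ^ x = (2 : ℝ≥0∞) ^ ((a : ℝ) * x) := by
  rw [ENNReal.rpow_mul, ENNReal.rpow_natCast]

/-! ### Sufficiency -/

lemma morrey_suff (d : ℕ) (u₁ p₁ u₂ p₂ : ℝ)
    (hp₁ : 0 < p₁) (hpu₁ : p₁ ≤ u₁) (hp₂ : 0 < p₂) (hpu₂ : p₂ ≤ u₂)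
    (hu : u₁ ≤ u₂) (hpu : p₂ / u₂ ≤ p₁ / u₁) (lam : (Fin d → ℤ) → ℂ) :
    morreyNorm d u₂ p₂ lam ≤ morreyNorm d u₁ p₁ lam := by
  have hu₁ : 0 < u₁ := by linarith
  have hu₂ : 0 < u₂ := by linarith
  set N := morreyNorm d u₁ p₁ lam with hN
  have hbase : ∀ (j : ℕ) (m : Fin d → ℤ), (2 : ℝ≥0∞) ^ ((j * d : ℕ) * (1 / u₁ - 1 / p₁)) *
      (∑ k ∈ dyCube d j m, (‖lam k‖₊ : ℝ≥0∞) ^ p₁) ^ (1 / p₁) ≤ N := by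
    intro j m
    rw [← two_pow_rpow, ← tsum_dyadic d j m (fun k => (‖lam k‖₊ : ℝ≥0∞) ^ p₁)]
    exact le_iSup₂ (f := fun (j : ℕ) (m : Fin d → ℤ) => ((2 : ℝ≥0∞) ^ (j * d)) ^ (1 / u₁ - 1 / p₁) *
      (∑' k : {k : Fin d → ℤ // inDyadic d j m k}, (‖lam k.1‖₊ : ℝ≥0∞) ^ p₁) ^ (1 / p₁)) j m
  have hsup : ∀ k, (‖lam k‖₊ : ℝ≥0∞) ≤ N := by
    intro k
    refine le_trans ?_ (hbase 0 k)
    have : dyCube d 0 k = {k} := by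
      ext x
      simp only [mem_dyCube, inDyadic, Finset.mem_singleton, pow_zero, one_mul]
      constructor
      · intro h; funext i; have := h i; omega
      · rintro rfl i; omega
    rw [this, Finset.sum_singleton, ← ENNReal.rpow_mul]
    simp [hp₁.ne']
  have hS : ∀ (j : ℕ) (m : Fin d → ℤ), ∑ k ∈ dyCube d j m, (‖lam k‖₊ : ℝ≥0∞) ^ p₁ ≤
      (2 : ℝ≥0∞) ^ ((j * d : ℕ) * (1 - p₁ / u₁)) * N ^ p₁ := by
    intro j m
    have h := ENNReal.rpow_le_rpow (hbase j m) hp₁.le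
    rw [ENNReal.mul_rpow_of_nonneg _ _ hp₁.le, ← ENNReal.rpow_mul, ← ENNReal.rpow_mul,
      one_div_mul_cancel hp₁.ne', ENNReal.rpow_one] at h
    refine le_trans (le_of_eq ?_) (mul_le_mul_right h _)
    rw [← mul_assoc, ← ENNReal.rpow_add _ _ (by simp) (by simp)]
    have : ((j * d : ℕ) : ℝ) * (1 - p₁ / u₁) + (j * d : ℕ) * (1 / u₁ - 1 / p₁) * p₁ = 0 := by
      field_simp; ring
    rw [this]; simp
  set q := p₁ * u₂ / u₁ with hq
  have hqp₁ : p₁ ≤ q := by rw [hq, le_div_iff₀ hu₁]; nlinarith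
  have hq0 : 0 < q := by linarith
  have hp₂q : p₂ ≤ q := by
    rw [div_le_div_iff₀ hu₂ hu₁] at hpu
    rw [hq, le_div_iff₀ hu₁]; exact hpu
  refine iSup₂_le fun j m => ?_
  rw [two_pow_rpow, tsum_dyadic d j m (fun k => (‖lam k‖₊ : ℝ≥0∞) ^ p₂)]
  have h1 := ENNReal.rpow_sum_le_const_mul_sum_rpow (dyCube d j m)
    (fun k => (‖lam k‖₊ : ℝ≥0∞) ^ p₂) (p := q / p₂) (by rw [le_div_iff₀ hp₂]; linarith)
  simp only [← ENNReal.rpow_mul, mul_div_cancel₀ q hp₂.ne', card_dyCube] at h1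
  have h2 : ∑ k ∈ dyCube d j m, (‖lam k‖₊ : ℝ≥0∞) ^ q ≤
      N ^ (q - p₁) * ∑ k ∈ dyCube d j m, (‖lam k‖₊ : ℝ≥0∞) ^ p₁ := by
    rw [Finset.mul_sum]
    refine Finset.sum_le_sum fun k _ => ?_
    have : q = (q - p₁) + p₁ := by ring
    conv_lhs => rw [this]
    rw [ENNReal.rpow_add_of_nonneg _ _ (by linarith) hp₁.le]
    gcongr
    exact hsup k
  have h3 : (∑ k ∈ dyCube d j m, (‖lam k‖₊ : ℝ≥0∞) ^ p₂) ^ (q / p₂) ≤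
      (2 : ℝ≥0∞) ^ ((j * d : ℕ) * (q / p₂ - p₁ / u₁)) * N ^ q := by
    calc _ ≤ _ := h1
      _ ≤ _ := mul_le_mul_right (h2.trans (mul_le_mul_right (hS j m) _)) _
      _ = _ := by
        rw [Nat.cast_pow, Nat.cast_ofNat, two_pow_rpow]
        have e1 : N ^ q = N ^ (q - p₁) * N ^ p₁ := by
          rw [← ENNReal.rpow_add_of_nonneg _ _ (by linarith) hp₁.le]; congr 1; ring
        have e2 : ((j * d : ℕ) : ℝ) * (q / p₂ - p₁ / u₁) =
          (j * d : ℕ) * (q / p₂ - 1) + (j * d : ℕ) * (1 - p₁ / u₁) := by ring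
        rw [e1, e2, ENNReal.rpow_add _ _ (by simp) (by simp)]
        ring
  have h4 := ENNReal.rpow_le_rpow h3 (z := 1 / q) (by positivity)
  rw [ENNReal.mul_rpow_of_nonneg _ _ (by positivity), ← ENNReal.rpow_mul, ← ENNReal.rpow_mul,
    ← ENNReal.rpow_mul, mul_one_div_cancel hq0.ne', ENNReal.rpow_one] at h4
  have e3 : q / p₂ * (1 / q) = 1 / p₂ := by field_simp
  rw [e3] at h4
  refine (mul_le_mul_right h4 _).trans (le_of_eq ?_)
  rw [← mul_assoc, ← ENNReal.rpow_add _ _ (by simp) (by simp)]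
  have : ((j * d : ℕ) : ℝ) * (1 / u₂ - 1 / p₂) + (j * d : ℕ) * (q / p₂ - p₁ / u₁) * (1 / q) = 0 := by
    rw [hq]; field_simp; ring
  rw [this]; simp

/-! ### Sparse sets -/

/-- Nonnegative integers whose binary digits outside `A` vanish. -/
def sparse (A : ℕ → Prop) : Set ℤ := {k | 0 ≤ k ∧ ∀ j : ℕ, k / 2 ^ j % 2 = 1 → A j}

open Classical in
/-- The part of the sparse set in a dyadic interval. -/
noncomputable def sparseIn (A : ℕ → Prop) (j : ℕ) (m : ℤ) : Finset ℤ :=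
  (Finset.Ico (2 ^ j * m) (2 ^ j * (m + 1))).filter (· ∈ sparse A)

lemma sparseIn_succ (A : ℕ → Prop) (j : ℕ) (m : ℤ) :
    sparseIn A (j + 1) m = sparseIn A j (2 * m) ∪ sparseIn A j (2 * m + 1) := by
  ext k
  simp only [sparseIn, Finset.mem_filter, Finset.mem_union, Finset.mem_Ico]
  have h : (0 : ℤ) < 2 ^ j := by positivity
  have e1 : (2 : ℤ) ^ (j + 1) * m = 2 ^ j * (2 * m) := by ring
  have e2 : (2 : ℤ) ^ (j + 1) * (m + 1) = 2 ^ j * (2 * m + 1 + 1) := by ring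
  rw [e1, e2]
  have e3 : (2 : ℤ) ^ j * (2 * m) < 2 ^ j * (2 * m + 1) := by nlinarith
  have e4 : (2 : ℤ) ^ j * (2 * m + 1) < 2 ^ j * (2 * m + 1 + 1) := by nlinarith
  rcases lt_or_ge k (2 ^ j * (2 * m + 1)) with h' | h' <;> constructor
  · rintro ⟨⟨a, b⟩, c⟩; exact Or.inl ⟨⟨a, h'⟩, c⟩
  · rintro (⟨⟨a, b⟩, c⟩ | ⟨⟨a, b⟩, c⟩)
    · exact ⟨⟨a, by linarith⟩, c⟩
    · exact ⟨⟨by linarith, b⟩, c⟩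
  · rintro ⟨⟨a, b⟩, c⟩; exact Or.inr ⟨⟨h', b⟩, c⟩
  · rintro (⟨⟨a, b⟩, c⟩ | ⟨⟨a, b⟩, c⟩)
    · exact ⟨⟨a, by linarith⟩, c⟩
    · exact ⟨⟨by linarith, b⟩, c⟩

lemma sparseIn_disj (A : ℕ → Prop) (j : ℕ) (m : ℤ) :
    Disjoint (sparseIn A j (2 * m)) (sparseIn A j (2 * m + 1)) := by
  rw [Finset.disjoint_left]
  intro k h1 h2
  simp only [sparseIn, Finset.mem_filter, Finset.mem_Ico] at h1 h2
  linarith [h1.1.2, h2.1.1]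

lemma sparseIn_odd (A : ℕ → Prop) (j : ℕ) (m : ℤ) (hj : ¬ A j) :
    sparseIn A j (2 * m + 1) = ∅ := by
  rw [Finset.eq_empty_iff_forall_notMem]
  intro k hk
  simp only [sparseIn, Finset.mem_filter, Finset.mem_Ico] at hk
  refine hj (hk.2.2 j ?_)
  have h : (0 : ℤ) < 2 ^ j := by positivity
  have : k / 2 ^ j = 2 * m + 1 := by
    apply le_antisymm
    · have := (Int.ediv_lt_iff_lt_mul h).2 (by linarith [hk.1.2] : k < (2 * m + 1 + 1) * 2 ^ j)
      omega
    · exact (Int.le_ediv_iff_mul_le h).2 (by linarith [hk.1.1])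
  omega

open Classical in
lemma card_sparseIn_le (A : ℕ → Prop) (j : ℕ) : ∀ m : ℤ,
    (sparseIn A j m).card ≤ 2 ^ (Nat.count A j) := by
  induction j with
  | zero =>
    intro m
    refine (Finset.card_filter_le _ _).trans ?_
    simp
  | succ j ih =>
    intro m
    rw [sparseIn_succ, Finset.card_union_of_disjoint (sparseIn_disj A j m), Nat.count_succ]
    by_cases hj : A j
    · rw [if_pos hj, pow_succ]
      have := ih (2 * m); have := ih (2 * m + 1); omega
    · rw [if_neg hj, sparseIn_odd A j m hj]
      simpa using ih (2 * m)

lemma sparse_shift (A : ℕ → Prop) (j : ℕ) (hj : A j) (k : ℤ) (hk : k ∈ sparse A)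
    (hlt : k < 2 ^ j) : k + 2 ^ j ∈ sparse A := by
  refine ⟨by have := hk.1; positivity, fun l hl => ?_⟩
  rcases lt_trichotomy l j with h | rfl | h
  · apply hk.2 l
    obtain ⟨c, rfl⟩ := Nat.exists_eq_add_of_lt h
    have e : (2 : ℤ) ^ (l + c + 1) = 2 ^ c * 2 * 2 ^ l := by ring
    rw [e, Int.add_mul_ediv_right _ _ (by positivity)] at hl
    omega
  · exact hj
  · exfalso
    have h0 : (k + 2 ^ j) / 2 ^ l = 0 := by
      apply Int.ediv_eq_zero_of_lt
      · have := hk.1; positivity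
      · calc k + 2 ^ j < 2 ^ (j + 1) := by rw [pow_succ]; linarith
          _ ≤ 2 ^ l := pow_le_pow_right₀ (by norm_num) h
    rw [h0] at hl; simp at hl

open Classical in
lemma le_card_sparseIn (A : ℕ → Prop) (j : ℕ) :
    2 ^ (Nat.count A j) ≤ (sparseIn A j 0).card := by
  induction j with
  | zero =>
    have : (0 : ℤ) ∈ sparseIn A 0 0 := by
      simp [sparseIn, sparse]
    simpa using Finset.card_pos.2 ⟨_, this⟩
  | succ j ih =>
    rw [sparseIn_succ, Finset.card_union_of_disjoint (sparseIn_disj A j 0), Nat.count_succ]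
    simp only [mul_zero, zero_add]
    by_cases hj : A j
    · rw [if_pos hj, pow_succ]
      have : (sparseIn A j 0).card ≤ (sparseIn A j 1).card := by
        apply Finset.card_le_card_of_injOn (fun k => k + 2 ^ j)
        · intro k hk
          simp only [sparseIn, Finset.coe_filter, Finset.mem_Ico, Set.mem_ofPred_eq] at hk ⊢
          refine ⟨⟨by linarith [hk.1.1], by linarith [hk.1.2]⟩,
            sparse_shift A j hj k hk.2 (by linarith [hk.1.2])⟩
        · intro a _ b _ h; simpa using h
      omega
    · rw [if_neg hj]; simp only [add_zero]; omega

open Classical in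
/-- Indicator of the `d`-fold product of the sparse set. -/
noncomputable def testSeq (d : ℕ) (A : ℕ → Prop) (k : Fin d → ℤ) : ℂ :=
  if ∀ i, k i ∈ sparse A then 1 else 0

lemma sum_testSeq (d : ℕ) (A : ℕ → Prop) (p : ℝ) (hp : 0 < p) (j : ℕ) (m : Fin d → ℤ) :
    ∑ k ∈ dyCube d j m, (‖testSeq d A k‖₊ : ℝ≥0∞) ^ p =
      ((∏ i, (sparseIn A j (m i)).card : ℕ) : ℝ≥0∞) := by
  classical
  rw [← Fintype.card_piFinset]
  have h1 : ∀ k, (‖testSeq d A k‖₊ : ℝ≥0∞) ^ p = if ∀ i, k i ∈ sparse A then 1 else 0 := by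
    intro k
    unfold testSeq
    split_ifs <;> simp [hp]
  simp only [h1]
  rw [Finset.sum_boole]
  congr 2
  ext k
  simp only [dyCube, sparseIn, Finset.mem_filter, Fintype.mem_piFinset]
  exact forall_and.symm

open Classical in
lemma norm_testSeq_le (d : ℕ) (A : ℕ → Prop) (u p : ℝ) (hp : 0 < p) (B : ℝ)
    (hB : ∀ j : ℕ, j * (1 / u - 1 / p) + Nat.count A j * (1 / p) ≤ B) :
    morreyNorm d u p (testSeq d A) ≤ (2 : ℝ≥0∞) ^ (d * B) := by
  refine iSup₂_le fun j m => ?_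
  rw [tsum_dyadic d j m (fun k => (‖testSeq d A k‖₊ : ℝ≥0∞) ^ p), sum_testSeq d A p hp]
  have h : (∏ i, (sparseIn A j (m i)).card) ≤ 2 ^ (Nat.count A j * d) := by
    rw [pow_mul]
    refine (Finset.prod_le_pow_card _ _ _ fun i _ => card_sparseIn_le A j (m i)).trans ?_
    simp
  have h' : ((∏ i, (sparseIn A j (m i)).card : ℕ) : ℝ≥0∞) ≤ 2 ^ (Nat.count A j * d) := by
    exact_mod_cast h
  refine (mul_le_mul_right (ENNReal.rpow_le_rpow h' (by positivity)) _).trans ?_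
  rw [two_pow_rpow, two_pow_rpow, ← ENNReal.rpow_add _ _ (by simp) (by simp)]
  refine ENNReal.rpow_le_rpow_of_exponent_le (by norm_num) ?_
  have := mul_le_mul_of_nonneg_left (hB j) (Nat.cast_nonneg (α := ℝ) d)
  push_cast
  linarith

open Classical in
lemma le_norm_testSeq (d : ℕ) (A : ℕ → Prop) (u p : ℝ) (hp : 0 < p) (j : ℕ) :
    (2 : ℝ≥0∞) ^ (d * (j * (1 / u - 1 / p) + Nat.count A j * (1 / p))) ≤
    morreyNorm d u p (testSeq d A) := by
  refine le_trans ?_ (le_iSup₂ (f := fun (j : ℕ) (m : Fin d → ℤ) =>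
    ((2 : ℝ≥0∞) ^ (j * d)) ^ (1 / u - 1 / p) *
      (∑' k : {k : Fin d → ℤ // inDyadic d j m k},
        (‖testSeq d A k.1‖₊ : ℝ≥0∞) ^ p) ^ (1 / p)) j 0)
  rw [tsum_dyadic d j 0 (fun k => (‖testSeq d A k‖₊ : ℝ≥0∞) ^ p), sum_testSeq d A p hp]
  have h : 2 ^ (Nat.count A j * d) ≤ (∏ i, (sparseIn A j ((0 : Fin d → ℤ) i)).card) := by
    simp only [Pi.zero_apply, Finset.prod_const, Finset.card_univ, Fintype.card_fin]
    rw [pow_mul]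
    exact Nat.pow_le_pow_left (le_card_sparseIn A j) _
  have h' : (2 : ℝ≥0∞) ^ (Nat.count A j * d) ≤
      ((∏ i, (sparseIn A j ((0 : Fin d → ℤ) i)).card : ℕ) : ℝ≥0∞) := by
    exact_mod_cast h
  refine le_trans ?_ (mul_le_mul_right (ENNReal.rpow_le_rpow h' (by positivity)) _)
  rw [two_pow_rpow, two_pow_rpow, ← ENNReal.rpow_add _ _ (by simp) (by simp)]
  refine le_of_eq ?_
  congr 1
  push_cast
  ring

/-- A linearly growing exponent is not bounded by a constant. -/
lemma exponent_bound (d : ℕ) (hd : 0 < d) (C : ℝ≥0) (a b : ℝ)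
    (h : ∀ j : ℕ, (2 : ℝ≥0∞) ^ (d * (j * a - b)) ≤ C) : a ≤ 0 := by
  by_contra ha
  push Not at ha
  obtain ⟨n, hn⟩ := pow_unbounded_of_one_lt C (by norm_num : (1 : ℝ≥0) < 2)
  obtain ⟨j, hj⟩ := exists_nat_ge ((n + b) / a)
  rw [div_le_iff₀ ha] at hj
  have h1 := h j
  have hd' : (1 : ℝ) ≤ d := by exact_mod_cast hd
  have h2 : (2 : ℝ≥0∞) ^ n ≤ (2 : ℝ≥0∞) ^ (d * (j * a - b)) := by
    rw [← ENNReal.rpow_natCast]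
    refine ENNReal.rpow_le_rpow_of_exponent_le (by norm_num) ?_
    have : (0 : ℝ) ≤ n := Nat.cast_nonneg n
    nlinarith
  have h3 : ((2 ^ n : ℝ≥0) : ℝ≥0∞) ≤ C := by push_cast; exact h2.trans h1
  exact absurd (ENNReal.coe_le_coe.1 h3) (not_le.2 hn)

lemma count_lt (J j : ℕ) [DecidablePred fun l => l < J] : Nat.count (fun l => l < J) j = min j J := by
  induction j with
  | zero => simp
  | succ j ih => rw [Nat.count_succ, ih]; split_ifs <;> omega

lemma count_floor (A : ℕ → Prop) [DecidablePred A] (α : ℝ)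
    (hA : ∀ l : ℕ, A l ↔ ⌊α * (l + 1)⌋₊ ≠ ⌊α * l⌋₊) (h0 : 0 ≤ α) (h1 : α ≤ 1) (j : ℕ) :
    Nat.count A j = ⌊α * j⌋₊ := by
  induction j with
  | zero => simp
  | succ j ih =>
    rw [Nat.count_succ, ih]
    push_cast
    have a : ⌊α * j⌋₊ ≤ ⌊α * (j + 1)⌋₊ := Nat.floor_le_floor (by nlinarith)
    have b : ⌊α * (j + 1)⌋₊ ≤ ⌊α * j⌋₊ + 1 := by
      rw [← Nat.floor_add_one (by positivity)]
      exact Nat.floor_le_floor (by nlinarith)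
    have c := hA j
    split_ifs with h
    · have := c.1 h; omega
    · have := mt c.2 h; omega

theorem morrey_embedding_iff (d : ℕ) (hd : 0 < d) (u₁ p₁ u₂ p₂ : ℝ)
    (hp₁ : 0 < p₁) (hpu₁ : p₁ ≤ u₁) (hp₂ : 0 < p₂) (hpu₂ : p₂ ≤ u₂) :
    (∃ C : ℝ≥0, 0 < C ∧ ∀ lam : (Fin d → ℤ) → ℂ, morreyNorm d u₁ p₁ lam ≠ ⊤ →
        morreyNorm d u₂ p₂ lam ≤ (C : ℝ≥0∞) * morreyNorm d u₁ p₁ lam) ↔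
      (u₁ ≤ u₂ ∧ p₂ / u₂ ≤ p₁ / u₁) := by
  classical
  have hu₁ : 0 < u₁ := by linarith
  have hu₂ : 0 < u₂ := by linarith
  constructor
  · rintro ⟨C, hC, H⟩
    have key : ∀ (A : ℕ → Prop) (B : ℝ),
        (∀ j : ℕ, j * (1 / u₁ - 1 / p₁) + Nat.count A j * (1 / p₁) ≤ B) → ∀ j : ℕ,
        (2 : ℝ≥0∞) ^ (d * (j * (1 / u₂ - 1 / p₂) + Nat.count A j * (1 / p₂) - B)) ≤ C := by
      intro A B hB j
      have h1 := norm_testSeq_le d A u₁ p₁ hp₁ B hB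
      have hfin : (2 : ℝ≥0∞) ^ (d * B) ≠ ⊤ := ENNReal.rpow_ne_top_of_ne_zero (by simp) (by simp)
      have h2 := (le_norm_testSeq d A u₂ p₂ hp₂ j).trans
        ((H _ (ne_top_of_le_ne_top hfin h1)).trans (mul_le_mul_right h1 _))
      rw [mul_sub, ENNReal.rpow_sub _ _ (by simp) (by simp)]
      exact ENNReal.div_le_of_le_mul h2
    constructor
    · have : 1 / u₂ - 1 / u₁ ≤ 0 := by
        refine exponent_bound d hd C _ 0 fun J => ?_
        have hle : 1 / u₁ ≤ 1 / p₁ := one_div_le_one_div_of_le hp₁ hpu₁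
        have := key (fun l => l < J) (J * (1 / u₁)) (fun j => by
          rw [count_lt]
          rcases le_total j J with h | h
          · rw [min_eq_left h]
            have h' : (j : ℝ) ≤ J := by exact_mod_cast h
            have : (j : ℝ) * (1 / u₁) ≤ J * (1 / u₁) := by gcongr
            linarith
          · rw [min_eq_right h]
            have h' : (J : ℝ) ≤ j := by exact_mod_cast h
            nlinarith) J
        rw [count_lt, min_self] at this
        refine le_trans (le_of_eq ?_) this
        congr 1
        ring
      have h : 1 / u₂ ≤ 1 / u₁ := by linarith
      exact (one_div_le_one_div hu₂ hu₁).1 h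
    · have hα0 : 0 ≤ 1 - p₁ / u₁ := by
        have := (div_le_one hu₁).2 hpu₁
        linarith
      have hα1 : 1 - p₁ / u₁ ≤ 1 := by
        have : 0 ≤ p₁ / u₁ := by positivity
        linarith
      have : (p₂ / u₂ - p₁ / u₁) * (1 / p₂) ≤ 0 := by
        refine exponent_bound d hd C _ (1 / p₂) fun J => ?_
        obtain ⟨A, hA⟩ : ∃ A : ℕ → Prop, ∀ l : ℕ,
            A l ↔ ⌊(1 - p₁ / u₁) * (l + 1)⌋₊ ≠ ⌊(1 - p₁ / u₁) * l⌋₊ := ⟨_, fun _ => Iff.rfl⟩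
        have := key A 0
          (fun j => by
            rw [count_floor A _ hA hα0 hα1]
            have hf : (⌊(1 - p₁ / u₁) * j⌋₊ : ℝ) ≤ (1 - p₁ / u₁) * j :=
              Nat.floor_le (by positivity)
            have hf' := mul_le_mul_of_nonneg_right hf (by positivity : 0 ≤ 1 / p₁)
            have e : (j : ℝ) * (1 / u₁ - 1 / p₁) + (1 - p₁ / u₁) * j * (1 / p₁) = 0 := by
              field_simp; ring
            linarith) J
        rw [count_floor A _ hA hα0 hα1] at this
        refine le_trans (ENNReal.rpow_le_rpow_of_exponent_le (by norm_num) ?_) this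
        refine mul_le_mul_of_nonneg_left ?_ (Nat.cast_nonneg d)
        have hf := (Nat.lt_floor_add_one ((1 - p₁ / u₁) * J)).le
        have hf' := mul_le_mul_of_nonneg_right hf (by positivity : 0 ≤ 1 / p₂)
        have e : (J : ℝ) * ((p₂ / u₂ - p₁ / u₁) * (1 / p₂)) =
            J * (1 / u₂ - 1 / p₂) + (1 - p₁ / u₁) * J * (1 / p₂) := by
          field_simp; ring
        linarith
      have hp : 0 < 1 / p₂ := by positivity
      by_contra hcon
      push Not at hcon
      have := mul_pos (sub_pos.2 hcon) hp
      linarith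
  · rintro ⟨hu, hpu⟩
    refine ⟨1, one_pos, fun lam _ => ?_⟩
    rw [ENNReal.coe_one, one_mul]
    exact morrey_suff d u₁ p₁ u₂ p₂ hp₁ hpu₁ hp₂ hpu₂ hu hpu lam
end

section
/- Let $1<p<u<\infty$ and $1\le q<\infty$. Then every bounded linear operator $T: m^{00}_{u,p}(\mathbb{Z}^d)\to\ell_q(\mathbb{Z}^d)$ is compact (Pitt-type theorem for Morrey sequence spaces). -/
open scoped ENNReal NNReal BigOperators
open Filter

namespace PittAux

theorem lq_add_le {ι : Type*} (q : ℝ) (hq : 1 ≤ q) (f g : ι → ℝ≥0∞) :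
    (∑' k, (f k + g k) ^ q) ^ (1 / q) ≤ (∑' k, f k ^ q) ^ (1 / q) + (∑' k, g k ^ q) ^ (1 / q) := by
  let _ : MeasurableSpace ι := ⊤
  have h := ENNReal.lintegral_Lp_add_le (μ := MeasureTheory.Measure.count) (p := q) (f := f) (g := g)
    measurable_from_top.aemeasurable measurable_from_top.aemeasurable hq
  simpa only [MeasureTheory.lintegral_count, Pi.add_apply] using h

theorem lq_norm_add_le {ι : Type*} (q : ℝ) (hq : 1 ≤ q) (f g : ι → ℂ) :
    (∑' k, (‖f k + g k‖₊ : ℝ≥0∞) ^ q) ^ (1 / q) ≤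
      (∑' k, (‖f k‖₊ : ℝ≥0∞) ^ q) ^ (1 / q) + (∑' k, (‖g k‖₊ : ℝ≥0∞) ^ q) ^ (1 / q) := by
  have hq0 : 0 < q := by linarith
  refine le_trans ?_ (lq_add_le q hq _ _)
  refine ENNReal.rpow_le_rpow ?_ (by positivity)
  refine ENNReal.tsum_le_tsum fun k => ?_
  refine ENNReal.rpow_le_rpow ?_ hq0.le
  exact_mod_cast nnnorm_add_le (f k) (g k)

theorem lpNorm_add_le (d : ℕ) (q : ℝ) (hq : 1 ≤ q) (f g : (Fin d → ℤ) → ℂ) :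
    lpNorm d q (f + g) ≤ lpNorm d q f + lpNorm d q g :=
  lq_norm_add_le q hq f g

/-- A single term of the Morrey norm. -/
noncomputable def mterm (d : ℕ) (u p : ℝ) (j : ℕ) (m : Fin d → ℤ) (lam : (Fin d → ℤ) → ℂ) : ℝ≥0∞ :=
  ((2 : ℝ≥0∞) ^ (j * d)) ^ (1 / u - 1 / p) *
      (∑' k : {k : Fin d → ℤ // inDyadic d j m k}, (‖lam k.1‖₊ : ℝ≥0∞) ^ p) ^ (1 / p)

theorem mterm_le (d : ℕ) (u p : ℝ) (j : ℕ) (m : Fin d → ℤ) (lam : (Fin d → ℤ) → ℂ) :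
    mterm d u p j m lam ≤ morreyNorm d u p lam :=
  le_iSup₂ (f := fun j m => mterm d u p j m lam) j m

theorem morrey_le_of (d : ℕ) (u p : ℝ) (lam : (Fin d → ℤ) → ℂ) (B : ℝ≥0∞)
    (h : ∀ j m, mterm d u p j m lam ≤ B) : morreyNorm d u p lam ≤ B :=
  iSup₂_le h

theorem mterm_add_le (d : ℕ) (u p : ℝ) (hp : 1 < p) (j : ℕ) (m : Fin d → ℤ)
    (f g : (Fin d → ℤ) → ℂ) :
    mterm d u p j m (f + g) ≤ mterm d u p j m f + mterm d u p j m g := by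
  unfold mterm
  rw [← mul_add]
  gcongr
  exact lq_norm_add_le p hp.le (fun k : {k : Fin d → ℤ // inDyadic d j m k} => f k.1) (fun k => g k.1)

theorem morrey_add_le (d : ℕ) (u p : ℝ) (hp : 1 < p) (f g : (Fin d → ℤ) → ℂ) :
    morreyNorm d u p (f + g) ≤ morreyNorm d u p f + morreyNorm d u p g :=
  morrey_le_of _ _ _ _ _ fun j m => (mterm_add_le d u p hp j m f g).trans
    (add_le_add (mterm_le ..) (mterm_le ..))

theorem mterm_mono (d : ℕ) (u p : ℝ) (hp : 1 < p) (j : ℕ) (m : Fin d → ℤ)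
    (f g : (Fin d → ℤ) → ℂ) (h : ∀ k, inDyadic d j m k → ‖f k‖ ≤ ‖g k‖) :
    mterm d u p j m f ≤ mterm d u p j m g := by
  have hp0 : 0 < p := by linarith
  unfold mterm
  gcongr with k
  exact h k.1 k.2

theorem morrey_mono (d : ℕ) (u p : ℝ) (hp : 1 < p)
    (f g : (Fin d → ℤ) → ℂ) (h : ∀ k, ‖f k‖ ≤ ‖g k‖) :
    morreyNorm d u p f ≤ morreyNorm d u p g :=
  morrey_le_of _ _ _ _ _ fun j m => (mterm_mono d u p hp j m f g fun k _ => h k).trans (mterm_le ..)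

theorem lq_smul {ι : Type*} (q : ℝ) (hq : 1 ≤ q) (c : ℂ) (f : ι → ℂ) :
    (∑' k, (‖c * f k‖₊ : ℝ≥0∞) ^ q) ^ (1 / q) = ‖c‖₊ * (∑' k, (‖f k‖₊ : ℝ≥0∞) ^ q) ^ (1 / q) := by
  have hq0 : 0 < q := by linarith
  simp only [nnnorm_mul, ENNReal.coe_mul]
  simp only [ENNReal.mul_rpow_of_nonneg _ _ hq0.le]
  rw [ENNReal.tsum_mul_left, ENNReal.mul_rpow_of_nonneg _ _ (by positivity), ← ENNReal.rpow_mul,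
    mul_one_div_cancel hq0.ne', ENNReal.rpow_one]

theorem lpNorm_smul (d : ℕ) (q : ℝ) (hq : 1 ≤ q) (c : ℂ) (f : (Fin d → ℤ) → ℂ) :
    lpNorm d q (c • f) = ‖c‖₊ * lpNorm d q f :=
  lq_smul q hq c f

theorem mterm_smul (d : ℕ) (u p : ℝ) (hp : 1 < p) (j : ℕ) (m : Fin d → ℤ) (c : ℂ)
    (f : (Fin d → ℤ) → ℂ) :
    mterm d u p j m (c • f) = ‖c‖₊ * mterm d u p j m f := by
  unfold mterm
  have := lq_smul p hp.le c (fun k : {k : Fin d → ℤ // inDyadic d j m k} => f k.1)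
  simp only [Pi.smul_apply, smul_eq_mul]
  rw [this]; ring

theorem morrey_smul_le (d : ℕ) (u p : ℝ) (hp : 1 < p) (c : ℂ) (f : (Fin d → ℤ) → ℂ) :
    morreyNorm d u p (c • f) ≤ ‖c‖₊ * morreyNorm d u p f :=
  morrey_le_of _ _ _ _ _ fun j m => by
    rw [mterm_smul _ _ _ hp]; gcongr; exact mterm_le ..

theorem expo_neg (u p : ℝ) (hp : 1 < p) (hpu : p < u) : 1 / u - 1 / p < 0 := by
  have : 1 / u < 1 / p := one_div_lt_one_div_of_lt (by linarith) hpu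
  linarith

theorem mterm_le_lp (d : ℕ) (u p : ℝ) (hp : 1 < p) (j : ℕ) (m : Fin d → ℤ)
    (f : (Fin d → ℤ) → ℂ) :
    mterm d u p j m f ≤ ((2 : ℝ≥0∞) ^ (j * d)) ^ (1 / u - 1 / p) * lpNorm d p f := by
  have hp0 : 0 < p := by linarith
  unfold mterm lpNorm
  gcongr
  exact ENNReal.tsum_comp_le_tsum_of_injective Subtype.val_injective
    (fun k => (‖f k‖₊ : ℝ≥0∞) ^ p)

theorem factor_le_one (d : ℕ) (u p : ℝ) (hp : 1 < p) (hpu : p < u) (j : ℕ) :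
    ((2 : ℝ≥0∞) ^ (j * d)) ^ (1 / u - 1 / p) ≤ 1 :=
  ENNReal.rpow_le_one_of_one_le_of_neg (one_le_pow₀ (by norm_num)) (expo_neg u p hp hpu)

theorem morrey_le_lp (d : ℕ) (u p : ℝ) (hp : 1 < p) (hpu : p < u) (f : (Fin d → ℤ) → ℂ) :
    morreyNorm d u p f ≤ lpNorm d p f :=
  morrey_le_of _ _ _ _ _ fun j m => (mterm_le_lp d u p hp j m f).trans <| by
    calc _ ≤ 1 * lpNorm d p f := by gcongr; exact factor_le_one d u p hp hpu j
      _ = _ := one_mul _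

theorem tsum_eq_sum_of_supp (d : ℕ) (q : ℝ) (hq : 1 ≤ q) (f : (Fin d → ℤ) → ℂ)
    (F : Finset (Fin d → ℤ)) (hF : ∀ k, k ∉ F → f k = 0) :
    ∑' k, (‖f k‖₊ : ℝ≥0∞) ^ q = ∑ k ∈ F, (‖f k‖₊ : ℝ≥0∞) ^ q := by
  have hq0 : 0 < q := by linarith
  refine tsum_eq_sum fun k hk => ?_
  simp [hF k hk, hq0]

theorem lp_lt_top (d : ℕ) (q : ℝ) (hq : 1 ≤ q) (f : (Fin d → ℤ) → ℂ)
    (hf : (Function.support f).Finite) : lpNorm d q f ≠ ⊤ := by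
  have hq0 : 0 < q := by linarith
  unfold lpNorm
  rw [tsum_eq_sum_of_supp d q hq f hf.toFinset (by simp)]
  refine ENNReal.rpow_ne_top_of_nonneg (by positivity) ?_
  refine ENNReal.sum_ne_top.2 fun k _ => ENNReal.rpow_ne_top_of_nonneg hq0.le (by simp)

theorem coord_le_lp (d : ℕ) (q : ℝ) (hq : 1 ≤ q) (f : (Fin d → ℤ) → ℂ) (k : Fin d → ℤ) :
    (‖f k‖₊ : ℝ≥0∞) ≤ lpNorm d q f := by
  have hq0 : 0 < q := by linarith
  unfold lpNorm
  rw [one_div, ENNReal.le_rpow_inv_iff hq0]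
  exact ENNReal.le_tsum (f := fun k => (‖f k‖₊ : ℝ≥0∞) ^ q) k

theorem coord_le_morrey (d : ℕ) (u p : ℝ) (hp : 1 < p) (f : (Fin d → ℤ) → ℂ) (k : Fin d → ℤ) :
    (‖f k‖₊ : ℝ≥0∞) ≤ morreyNorm d u p f := by
  have hp0 : 0 < p := by linarith
  refine le_trans ?_ (mterm_le d u p 0 k f)
  unfold mterm
  simp only [zero_mul, pow_zero, ENNReal.one_rpow, one_mul]
  rw [one_div, ENNReal.le_rpow_inv_iff hp0]
  refine ENNReal.le_tsum (f := fun l : {l : Fin d → ℤ // inDyadic d 0 k l} => (‖f l.1‖₊ : ℝ≥0∞) ^ p)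
    ⟨k, fun i => by simp⟩

theorem mem00_fin (d : ℕ) (u p : ℝ) (hp : 1 < p) (hpu : p < u) (f : (Fin d → ℤ) → ℂ)
    (hf : (Function.support f).Finite) : MemMorrey00 d u p f := by
  refine ⟨((morrey_le_lp d u p hp hpu f).trans_lt (lp_lt_top d p hp.le f hf).lt_top).ne,
    fun ε hε => ⟨f, hf, ?_⟩⟩
  have hp0 : 0 < p := by linarith
  have : morreyNorm d u p (f - f) ≤ 0 := by
    refine (morrey_le_lp d u p hp hpu _).trans ?_
    simp [lpNorm, hp0]
  exact this.trans_lt hε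

/-- Adding something far away. -/
theorem far_add (d : ℕ) (u p : ℝ) (hp : 1 < p) (hpu : p < u) (S : (Fin d → ℤ) → ℂ)
    (hS : (Function.support S).Finite) :
    ∃ F : Set (Fin d → ℤ), F.Finite ∧ ∀ x : (Fin d → ℤ) → ℂ, (∀ k ∈ F, x k = 0) →
      morreyNorm d u p (S + x) ≤ max (morreyNorm d u p S) (morreyNorm d u p x + 1) := by
  have hneg := expo_neg u p hp hpu
  -- choose the level
  obtain ⟨J, hJ⟩ : ∃ J : ℕ, ∀ j : ℕ, J < j → 0 < d →
      ((2 : ℝ≥0∞) ^ (j * d)) ^ (1 / u - 1 / p) * lpNorm d p S ≤ 1 := by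
    set L := lpNorm d p S with hL
    have hLt : L ≠ ⊤ := lp_lt_top d p hp.le S hS
    have hr : ((2 : ℝ≥0∞) ^ (1 / u - 1 / p)) < 1 :=
      ENNReal.rpow_lt_one_of_one_lt_of_neg (by norm_num) hneg
    have ht : Tendsto (fun n : ℕ => ((2 : ℝ≥0∞) ^ (1 / u - 1 / p)) ^ n * L) atTop (nhds (0 * L)) :=
      ENNReal.Tendsto.mul_const (ENNReal.tendsto_pow_atTop_nhds_zero_of_lt_one hr) (Or.inr hLt)
    rw [zero_mul] at ht
    obtain ⟨J, hJ⟩ := eventually_atTop.1 (ht.eventually (ge_mem_nhds (zero_lt_one (α := ℝ≥0∞))))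
    refine ⟨J, fun j hj hd => ?_⟩
    have h1 : J ≤ j * d := hj.le.trans (Nat.le_mul_of_pos_right j hd)
    have h2 := hJ _ h1
    have e : ((2 : ℝ≥0∞) ^ (j * d)) ^ (1 / u - 1 / p) =
        ((2 : ℝ≥0∞) ^ (1 / u - 1 / p)) ^ (j * d) := by
      rw [← ENNReal.rpow_natCast, ← ENNReal.rpow_natCast, ← ENNReal.rpow_mul, ← ENNReal.rpow_mul,
        mul_comm]
    rw [e]; exact h2
  refine ⟨⋃ k0 ∈ Function.support S, Set.Icc (fun i => k0 i - 2 ^ J) (fun i => k0 i + 2 ^ J),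
    hS.biUnion fun k0 _ => Set.finite_Icc _ _, fun x hx => ?_⟩
  refine morrey_le_of _ _ _ _ _ fun j m => ?_
  by_cases h1 : ∃ k0, inDyadic d j m k0 ∧ S k0 ≠ 0
  · obtain ⟨k0, hk0, hSk⟩ := h1
    by_cases h2 : ∃ k1, inDyadic d j m k1 ∧ x k1 ≠ 0
    · obtain ⟨k1, hk1, hxk⟩ := h2
      have hnot : k1 ∉ ⋃ k0 ∈ Function.support S,
        Set.Icc (fun i => k0 i - 2 ^ J) (fun i => k0 i + 2 ^ J) := fun h => hxk (hx _ h)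
      simp only [Set.mem_iUnion, not_exists] at hnot
      have h3 := hnot k0 hSk
      simp only [Set.mem_Icc, Pi.le_def, not_and_or, not_forall] at h3
      have key : J < j ∧ 0 < d := by
        have : ∃ i : Fin d, (2:ℤ) ^ J < 2 ^ j := by
          rcases h3 with ⟨i, hi⟩ | ⟨i, hi⟩
          · refine ⟨i, ?_⟩
            have a := hk0 i
            have b := hk1 i
            rw [mul_add] at a b
            linarith
          · refine ⟨i, ?_⟩
            have a := hk0 i
            have b := hk1 i
            rw [mul_add] at a b
            linarith
        obtain ⟨i, hi⟩ := this
        exact ⟨(pow_lt_pow_iff_right₀ (by norm_num)).1 hi, i.pos⟩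
      refine le_trans ?_ (le_max_right _ _)
      refine (mterm_add_le d u p hp j m S x).trans ?_
      rw [add_comm]
      exact add_le_add (mterm_le ..) ((mterm_le_lp d u p hp j m S).trans (hJ j key.1 key.2))
    · push Not at h2
      refine le_trans ?_ (le_max_left _ _)
      refine le_trans (mterm_mono d u p hp j m _ S fun k hk => ?_) (mterm_le ..)
      simp [h2 k hk]
  · push Not at h1
    refine le_trans ?_ (le_max_right _ _)
    refine le_trans (mterm_mono d u p hp j m _ x fun k hk => ?_) ((mterm_le ..).trans le_self_add)
    simp [h1 k hk]

/-- Iteration. -/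
theorem iter (d : ℕ) (u p : ℝ) (hp : 1 < p) (hpu : p < u)
    (P : ℕ → ((Fin d → ℤ) → ℂ) → Prop) (h0 : P 0 0)
    (hs : ∀ n S, (Function.support S).Finite → morreyNorm d u p S ≤ 2 → P n S →
      ∀ F : Set (Fin d → ℤ), F.Finite → ∃ x : (Fin d → ℤ) → ℂ, (Function.support x).Finite ∧
        (∀ k ∈ F, x k = 0) ∧ morreyNorm d u p x ≤ 1 ∧ P (n + 1) (S + x)) (n : ℕ) :
    ∃ S, (Function.support S).Finite ∧ morreyNorm d u p S ≤ 2 ∧ P n S := by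
  induction n with
  | zero =>
    have hp0 : 0 < p := by linarith
    refine ⟨0, by simp, ?_, h0⟩
    refine (morrey_le_lp d u p hp hpu _).trans ?_
    simp [lpNorm, hp0]
  | succ n ih =>
    obtain ⟨S, hS, hn, hP⟩ := ih
    obtain ⟨F, hF, hF2⟩ := far_add d u p hp hpu S hS
    obtain ⟨x, hx, hxF, hx1, hxP⟩ := hs n S hS hn hP F hF
    refine ⟨S + x, (hS.union hx).subset (Function.support_add _ _), ?_, hxP⟩
    refine (hF2 x hxF).trans (max_le hn ?_)
    calc _ ≤ (1 : ℝ≥0∞) + 1 := by gcongr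
      _ = 2 := by norm_num

theorem two_point (q : ℝ) (hq : 1 ≤ q) (a b : ℂ) :
    2 * (‖a‖₊ : ℝ≥0∞) ^ q ≤ (‖a + b‖₊ : ℝ≥0∞) ^ q + (‖a - b‖₊ : ℝ≥0∞) ^ q := by
  have hq0 : 0 < q := by linarith
  have h := NNReal.rpow_arith_mean_le_arith_mean2_rpow (1 / 2) (1 / 2) ‖a + b‖₊ ‖a - b‖₊
    (by norm_num) hq
  have h2 : ‖a‖₊ ≤ 1 / 2 * ‖a + b‖₊ + 1 / 2 * ‖a - b‖₊ := by
    rw [← NNReal.coe_le_coe]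
    push_cast
    have h3 := norm_add_le (a + b) (a - b)
    have h4 : a + b + (a - b) = 2 * a := by ring
    rw [h4, norm_mul] at h3
    simp at h3
    linarith
  have h5 := (NNReal.rpow_le_rpow h2 hq0.le).trans h
  have h6 : 2 * ‖a‖₊ ^ q ≤ ‖a + b‖₊ ^ q + ‖a - b‖₊ ^ q := by
    calc 2 * ‖a‖₊ ^ q ≤ 2 * (1 / 2 * ‖a + b‖₊ ^ q + 1 / 2 * ‖a - b‖₊ ^ q) := by gcongr
      _ = (2 * (1 / 2)) * (‖a + b‖₊ ^ q + ‖a - b‖₊ ^ q) := by ring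
      _ = _ := by norm_num
  rw [← ENNReal.coe_rpow_of_nonneg _ hq0.le, ← ENNReal.coe_rpow_of_nonneg _ hq0.le,
    ← ENNReal.coe_rpow_of_nonneg _ hq0.le]
  exact_mod_cast h6

theorem two_point' (q : ℝ) (hq : 1 ≤ q) (a b : ℂ) :
    2 * (‖b‖₊ : ℝ≥0∞) ^ q ≤ (‖a + b‖₊ : ℝ≥0∞) ^ q + (‖a - b‖₊ : ℝ≥0∞) ^ q := by
  have := two_point q hq b a
  rwa [add_comm b a, show ‖b - a‖₊ = ‖a - b‖₊ from NNReal.eq (norm_sub_rev b a)] at this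

theorem split_sum {ι : Type*} (f : ι → ℝ≥0∞) (K : Finset ι) :
    ∑ k ∈ K, f k + ∑' k : {k // k ∉ K}, f k = ∑' k, f k := by
  have h := Summable.tsum_add_tsum_compl (f := f) (s := (K : Set ι)) ENNReal.summable ENNReal.summable
  rw [← h]
  congr 1
  exact (Finset.tsum_subtype K f).symm

theorem sign_choice {ι : Type*} (q : ℝ) (hq : 1 ≤ q) (y z : ι → ℂ) (K : Finset ι) (D : ℝ≥0∞)
    (hD : D ≠ ⊤)
    (hy : ∑' k : {k // k ∉ K}, (‖y k‖₊ : ℝ≥0∞) ^ q ≤ D / 4)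
    (hz : ∑ k ∈ K, (‖z k‖₊ : ℝ≥0∞) ^ q ≤ D / 4)
    (hzD : D ≤ ∑' k, (‖z k‖₊ : ℝ≥0∞) ^ q) :
    ∑' k, (‖y k‖₊ : ℝ≥0∞) ^ q + D / 2 ≤ ∑' k, (‖y k + z k‖₊ : ℝ≥0∞) ^ q ∨
    ∑' k, (‖y k‖₊ : ℝ≥0∞) ^ q + D / 2 ≤ ∑' k, (‖y k - z k‖₊ : ℝ≥0∞) ^ q := by
  have hD2 : D / 2 ≠ ⊤ := ENNReal.div_ne_top hD (by norm_num)
  have h44 : D / 4 + D / 4 = D / 2 := by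
    rw [← two_mul, div_eq_mul_inv, div_eq_mul_inv, show (4 : ℝ≥0∞) = 2 * 2 by norm_num,
      ENNReal.mul_inv (by norm_num) (by norm_num)]
    rw [show (2 : ℝ≥0∞) * (D * (2⁻¹ * 2⁻¹)) = (2 * 2⁻¹) * (D * 2⁻¹) by ring,
      ENNReal.mul_inv_cancel (by norm_num) (by norm_num), one_mul]
  set W := ∑ k ∈ K, (‖y k‖₊ : ℝ≥0∞) ^ q + ∑' k : {k // k ∉ K}, (‖z k‖₊ : ℝ≥0∞) ^ q with hW
  have h1 : W + W ≤ ∑' k, (‖y k + z k‖₊ : ℝ≥0∞) ^ q + ∑' k, (‖y k - z k‖₊ : ℝ≥0∞) ^ q := by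
    rw [← ENNReal.tsum_add, ← split_sum _ K, ← two_mul, hW, mul_add, Finset.mul_sum,
      ← ENNReal.tsum_mul_left]
    gcongr with k hk k
    · exact two_point q hq _ _
    · exact two_point' q hq _ _
  have h2 : ∑' k, (‖y k‖₊ : ℝ≥0∞) ^ q + D / 2 ≤ W := by
    have : ∑' k, (‖y k‖₊ : ℝ≥0∞) ^ q + D / 2 + D / 2 ≤ W + D / 2 := by
      rw [add_assoc, ENNReal.add_halves]
      calc _ ≤ ∑' k, (‖y k‖₊ : ℝ≥0∞) ^ q + ∑' k, (‖z k‖₊ : ℝ≥0∞) ^ q := by gcongr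
        _ = (∑ k ∈ K, (‖y k‖₊ : ℝ≥0∞) ^ q + ∑' k : {k // k ∉ K}, (‖y k‖₊ : ℝ≥0∞) ^ q) +
            (∑ k ∈ K, (‖z k‖₊ : ℝ≥0∞) ^ q + ∑' k : {k // k ∉ K}, (‖z k‖₊ : ℝ≥0∞) ^ q) := by
              rw [split_sum (fun k => (‖y k‖₊ : ℝ≥0∞) ^ q) K,
                split_sum (fun k => (‖z k‖₊ : ℝ≥0∞) ^ q) K]
        _ ≤ (∑ k ∈ K, (‖y k‖₊ : ℝ≥0∞) ^ q + D / 4) +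
            (D / 4 + ∑' k : {k // k ∉ K}, (‖z k‖₊ : ℝ≥0∞) ^ q) := by gcongr
        _ = W + (D / 4 + D / 4) := by rw [hW]; ring
        _ = _ := by rw [h44]
    exact (ENNReal.add_le_add_iff_right hD2).1 this
  by_contra hcon
  push Not at hcon
  have := ENNReal.add_lt_add (hcon.1.trans_le h2) (hcon.2.trans_le h2)
  exact absurd h1 (not_le.2 this)

/-- The bundle of hypotheses on the operator. -/
structure Op (d : ℕ) (u p q : ℝ) (T : ((Fin d → ℤ) → ℂ) → (Fin d → ℤ) → ℂ) (C : ℝ≥0∞) : Prop where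
  hp : 1 < p
  hpu : p < u
  hq : 1 ≤ q
  hC : C ≠ ⊤
  hadd : ∀ lam mu : (Fin d → ℤ) → ℂ, MemMorrey00 d u p lam → MemMorrey00 d u p mu →
      T (lam + mu) = T lam + T mu
  hsmul : ∀ (c : ℂ) (lam : (Fin d → ℤ) → ℂ), MemMorrey00 d u p lam → T (c • lam) = c • T lam
  hb : ∀ lam : (Fin d → ℤ) → ℂ, MemMorrey00 d u p lam →
      lpNorm d q (T lam) ≤ C * morreyNorm d u p lam

theorem Op.mem {d u p q T C} (h : Op d u p q T C) (x : (Fin d → ℤ) → ℂ)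
    (hx : (Function.support x).Finite) : MemMorrey00 d u p x := mem00_fin d u p h.hp h.hpu x hx

theorem Op.zero {d u p q T C} (h : Op d u p q T C) : T 0 = 0 := by
  have := h.hsmul 0 0 (h.mem 0 (by simp))
  simpa using this

theorem morrey_smul_one (d : ℕ) (u p : ℝ) (hp : 1 < p) (c : ℂ) (hc : ‖c‖ ≤ 1) (f : (Fin d → ℤ) → ℂ)
    (hf : morreyNorm d u p f ≤ 1) : morreyNorm d u p (c • f) ≤ 1 := by
  refine (morrey_mono d u p hp _ f fun k => ?_).trans hf
  simp only [Pi.smul_apply, smul_eq_mul, norm_mul]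
  exact mul_le_of_le_one_left (norm_nonneg _) hc

theorem supp_smul {d : ℕ} (c : ℂ) (f : (Fin d → ℤ) → ℂ) (hf : (Function.support f).Finite) :
    (Function.support (c • f)).Finite :=
  hf.subset (Function.support_const_smul_subset c f)

theorem coord_small {d u p q T C} (h : Op d u p q T C) (k : Fin d → ℤ) (δ : ℝ≥0∞) (hδ : 0 < δ) :
    ∃ F : Set (Fin d → ℤ), F.Finite ∧ ∀ x : (Fin d → ℤ) → ℂ, (Function.support x).Finite →
      (∀ k ∈ F, x k = 0) → morreyNorm d u p x ≤ 1 → (‖T x k‖₊ : ℝ≥0∞) ≤ δ := by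
  by_contra hcon
  push Not at hcon
  have hδt : δ ≠ ⊤ := by
    obtain ⟨x, _, _, _, hx⟩ := hcon ∅ Set.finite_empty
    exact (hx.trans ENNReal.coe_lt_top).ne
  lift δ to ℝ≥0 using hδt
  have hδ' : 0 < (δ : ℝ) := by exact_mod_cast hδ
  have key := iter d u p h.hp h.hpu (fun n S => (n : ℝ) * δ ≤ (T S k).re) (by simp [h.zero]) (by
    intro n S hS hS2 hP F hF
    obtain ⟨x, hx, hxF, hx1, hxk⟩ := hcon F hF
    set z := T x k with hz
    have hzδ : (δ : ℝ) < ‖z‖ := by exact_mod_cast hxk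
    have hz0 : (‖z‖ : ℂ) ≠ 0 := by
      have : 0 < ‖z‖ := hδ'.trans hzδ
      exact_mod_cast this.ne'
    set c : ℂ := (starRingEnd ℂ) z / ‖z‖ with hc
    have hcn : ‖c‖ ≤ 1 := by
      rw [hc, norm_div]; simp; exact div_self_le_one _
    have hcz : c * z = ‖z‖ := by
      rw [hc, div_mul_eq_mul_div, mul_comm, Complex.mul_conj, Complex.normSq_eq_norm_sq]
      field_simp
      push_cast; ring
    have hcs := supp_smul c x hx
    refine ⟨c • x, hcs, fun k hk => by simp [hxF k hk],
      morrey_smul_one d u p h.hp c hcn x hx1, ?_⟩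
    rw [h.hadd _ _ (h.mem _ hS) (h.mem _ hcs), h.hsmul _ _ (h.mem _ hx)]
    simp only [Pi.add_apply, Pi.smul_apply, smul_eq_mul, Complex.add_re]
    rw [← hz, hcz, Complex.ofReal_re]
    push_cast
    linarith)
  obtain ⟨n, hn⟩ := exists_nat_gt ((C * 2).toReal / δ)
  obtain ⟨S, hS, hS2, hP⟩ := key n
  have h1 : (‖T S k‖₊ : ℝ≥0∞) ≤ C * 2 := (coord_le_lp d q h.hq _ k).trans
    ((h.hb S (h.mem S hS)).trans (by gcongr))
  have hCt : C * 2 ≠ ⊤ := ENNReal.mul_ne_top h.hC (by norm_num)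
  have h2 : ‖T S k‖ ≤ (C * 2).toReal := by
    have := ENNReal.toReal_mono hCt h1
    simpa using this
  rw [div_lt_iff₀ hδ'] at hn
  have := Complex.re_le_norm (T S k)
  linarith

theorem op_small {d u p q T C} (h : Op d u p q T C) (δ : ℝ≥0∞) (hδ : 0 < δ) :
    ∃ F : Set (Fin d → ℤ), F.Finite ∧ ∀ x : (Fin d → ℤ) → ℂ, (Function.support x).Finite →
      (∀ k ∈ F, x k = 0) → morreyNorm d u p x ≤ 1 → lpNorm d q (T x) ≤ δ := by
  by_contra hcon
  push Not at hcon
  have hq0 : 0 < q := by linarith [h.hq]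
  have hδt : δ ≠ ⊤ := by
    obtain ⟨x, _, _, _, hx⟩ := hcon ∅ Set.finite_empty
    exact hx.ne_top
  set D := δ ^ q with hD
  have hDt : D ≠ ⊤ := ENNReal.rpow_ne_top_of_nonneg hq0.le hδt
  have hD0 : 0 < D := ENNReal.rpow_pos hδ hδt
  have hfin : ∀ S : (Fin d → ℤ) → ℂ, (Function.support S).Finite → morreyNorm d u p S ≤ 2 →
      ∑' k, (‖T S k‖₊ : ℝ≥0∞) ^ q ≤ (C * 2) ^ q := by
    intro S hS hS2
    have : lpNorm d q (T S) ≤ C * 2 := (h.hb S (h.mem S hS)).trans (by gcongr)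
    unfold lpNorm at this
    rwa [one_div, ENNReal.rpow_inv_le_iff hq0] at this
  have hCt : (C * 2) ^ q ≠ ⊤ :=
    ENNReal.rpow_ne_top_of_nonneg hq0.le (ENNReal.mul_ne_top h.hC (by norm_num))
  have key := iter d u p h.hp h.hpu
    (fun n S => (n : ℝ≥0∞) * (D / 2) ≤ ∑' k, (‖T S k‖₊ : ℝ≥0∞) ^ q) (by simp) (by
    intro n S hS hS2 hP F hF
    have hy := ((hfin S hS hS2).trans_lt hCt.lt_top).ne
    have hD4 : 0 < D / 4 := ENNReal.div_pos hD0.ne' (by norm_num)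
    obtain ⟨K, hK⟩ := ((ENNReal.tendsto_tsum_compl_atTop_zero hy).eventually
      (ge_mem_nhds hD4)).exists
    set e : ℝ≥0∞ := D / 4 / (K.card + 1) with he
    have he0 : 0 < e := ENNReal.div_pos hD4.ne' (by finiteness)
    have het : e ≠ ⊤ := ENNReal.div_ne_top (ENNReal.div_ne_top hDt (by norm_num)) (by simp)
    choose G hGf hG using fun k => coord_small h k (e ^ (1 / q)) (ENNReal.rpow_pos he0 het)
    obtain ⟨x, hx, hxF, hx1, hxq⟩ := hcon (F ∪ ⋃ k ∈ K, G k)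
      (hF.union (K.finite_toSet.biUnion fun k _ => hGf k))
    have hzK : ∑ k ∈ K, (‖T x k‖₊ : ℝ≥0∞) ^ q ≤ D / 4 := by
      have : ∀ k ∈ K, (‖T x k‖₊ : ℝ≥0∞) ^ q ≤ e := by
        intro k hk
        have := hG k x hx (fun l hl => hxF l (Or.inr (Set.mem_biUnion hk hl))) hx1
        rwa [one_div, ENNReal.le_rpow_inv_iff hq0] at this
      calc _ ≤ K.card • e := Finset.sum_le_card_nsmul _ _ _ this
        _ = K.card * e := by simp
        _ ≤ (K.card + 1) * e := by gcongr; simp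
        _ ≤ D / 4 := ENNReal.mul_div_le
    have hzD : D ≤ ∑' k, (‖T x k‖₊ : ℝ≥0∞) ^ q := by
      have := hxq.le
      unfold lpNorm at this
      rwa [one_div, ENNReal.le_rpow_inv_iff hq0] at this
    have hx' := supp_smul (-1) x hx
    have hstep : ((n + 1 : ℕ) : ℝ≥0∞) * (D / 2) ≤ ∑' k, (‖T S k‖₊ : ℝ≥0∞) ^ q + D / 2 := by
      push_cast
      rw [add_mul, one_mul]
      gcongr
    rcases sign_choice q h.hq (T S) (T x) K D hDt hK hzK hzD with h1 | h1
    · refine ⟨x, hx, fun k hk => hxF k (Or.inl hk), hx1, hstep.trans ?_⟩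
      rw [h.hadd _ _ (h.mem _ hS) (h.mem _ hx)]
      exact h1
    · refine ⟨(-1 : ℂ) • x, hx', fun k hk => by simp [hxF k (Or.inl hk)],
        morrey_smul_one d u p h.hp _ (by simp) x hx1, hstep.trans ?_⟩
      rw [h.hadd _ _ (h.mem _ hS) (h.mem _ hx'), h.hsmul _ _ (h.mem _ hx)]
      simpa [sub_eq_add_neg] using h1)
  have hD2 : D / 2 ≠ 0 := (ENNReal.div_pos hD0.ne' (by norm_num)).ne'
  obtain ⟨n, hn⟩ := ENNReal.exists_nat_mul_gt hD2 hCt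
  obtain ⟨S, hS, hS2, hP⟩ := key n
  exact absurd (hP.trans (hfin S hS hS2)) (not_le.2 hn)

theorem net {d : ℕ} {p : ℝ} (hp : 1 < p) (F : Finset (Fin d → ℤ)) (a : ℝ≥0∞) (ha : 0 < a)
    (hat : a ≠ ⊤) :
    ∃ V : Set ((Fin d → ℤ) → ℂ), V.Finite ∧ (∀ v ∈ V, (Function.support v).Finite) ∧
      ∀ w : (Fin d → ℤ) → ℂ, (∀ k, k ∉ F → w k = 0) → (∀ k, ‖w k‖ ≤ 2) →
        ∃ v ∈ V, lpNorm d p (w - v) ≤ a := by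
  classical
  have hp0 : 0 < p := by linarith
  set e : ℝ≥0∞ := a ^ p / (F.card + 1) with he
  have he0 : 0 < e := ENNReal.div_pos (ENNReal.rpow_pos ha hat).ne' (by finiteness)
  have het : e ≠ ⊤ := ENNReal.div_ne_top (ENNReal.rpow_ne_top_of_nonneg hp0.le hat) (by simp)
  set r : ℝ≥0∞ := e ^ (1 / p) with hr
  have hr0 : 0 < r := ENNReal.rpow_pos he0 het
  have hrt : r ≠ ⊤ := ENNReal.rpow_ne_top_of_nonneg (by positivity) het
  obtain ⟨G, -, hGf, hG⟩ := (isCompact_closedBall (0 : ℂ) 2).finite_cover_balls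
    (ENNReal.toReal_pos hr0.ne' hrt)
  let ext : (F → ℂ) → (Fin d → ℤ) → ℂ := fun g k => if hk : k ∈ F then g ⟨k, hk⟩ else 0
  have hext : ∀ g k, k ∉ F → ext g k = 0 := fun g k hk => by simp [ext, hk]
  refine ⟨ext '' {g | ∀ k, g k ∈ G}, (Set.Finite.pi' fun _ => hGf).image _, ?_, ?_⟩
  · rintro _ ⟨g, _, rfl⟩
    refine F.finite_toSet.subset fun k hk => ?_
    by_contra hk'
    exact hk (hext g k hk')
  · intro w hwF hw
    have : ∀ k : F, ∃ c ∈ G, ‖w k - c‖ < r.toReal := by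
      intro k
      have h1 := hG (show w k ∈ Metric.closedBall (0 : ℂ) 2 by simpa using hw k)
      simp only [Set.mem_iUnion, Metric.mem_ball, dist_eq_norm] at h1
      obtain ⟨c, hc, hc2⟩ := h1
      exact ⟨c, hc, hc2⟩
    choose g hgG hg using this
    refine ⟨ext g, ⟨g, hgG, rfl⟩, ?_⟩
    unfold lpNorm
    rw [tsum_eq_sum_of_supp d p hp.le _ F (fun k hk => by simp [hwF k hk, hext g k hk]),
      one_div, ENNReal.rpow_inv_le_iff hp0]
    have hb : ∀ k ∈ F, (‖(w - ext g) k‖₊ : ℝ≥0∞) ^ p ≤ e := by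
      intro k hk
      have h1 : (‖(w - ext g) k‖₊ : ℝ≥0∞) ≤ r := by
        have h2 := (hg ⟨k, hk⟩).le
        have h3 : (w - ext g) k = w k - g ⟨k, hk⟩ := by simp [ext, hk]
        rw [h3, ← ENNReal.ofReal_toReal hrt]
        rw [← enorm_eq_nnnorm, ← ofReal_norm]
        exact ENNReal.ofReal_le_ofReal h2
      rwa [hr, one_div, ENNReal.le_rpow_inv_iff hp0] at h1
    calc _ ≤ F.card • e := Finset.sum_le_card_nsmul _ _ _ hb
      _ = F.card * e := by simp
      _ ≤ (F.card + 1) * e := by gcongr; simp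
      _ ≤ a ^ p := ENNReal.mul_div_le

theorem main {d u p q T C} (h : Op d u p q T C) (ε : ℝ≥0∞) (hε : 0 < ε) :
    ∃ Y : Set ((Fin d → ℤ) → ℂ), Y.Finite ∧
      ∀ lam : (Fin d → ℤ) → ℂ, MemMorrey00 d u p lam → morreyNorm d u p lam ≤ 1 →
        ∃ y ∈ Y, lpNorm d q (T lam - y) < ε := by
  classical
  obtain ⟨e, he0, het, he⟩ : ∃ e : ℝ≥0∞, 0 < e ∧ e ≠ ⊤ ∧ e + e + e < ε := by
    have hm0 : 0 < min ε 1 := lt_min hε one_pos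
    have hmt : min ε 1 ≠ ⊤ := ((min_le_right _ _).trans_lt ENNReal.one_lt_top).ne
    have hm4 : 0 < min ε 1 / 4 := ENNReal.div_pos hm0.ne' (by norm_num)
    have hm4t : min ε 1 / 4 ≠ ⊤ := ENNReal.div_ne_top hmt (by norm_num)
    refine ⟨min ε 1 / 4, hm4, hm4t, ?_⟩
    have h4 : 4 * (min ε 1 / 4) = min ε 1 := ENNReal.mul_div_cancel (by norm_num) (by norm_num)
    refine lt_of_lt_of_le ?_ (h4.le.trans (min_le_left _ _))
    set m := min ε 1 / 4
    rw [show (4 : ℝ≥0∞) * m = m + m + m + m by ring]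
    exact ENNReal.lt_add_right (by finiteness) hm4.ne'
  set a : ℝ≥0∞ := e / (C + 1) with ha
  have ha0 : 0 < a := ENNReal.div_pos he0.ne' (by have := h.hC; finiteness)
  have hat : a ≠ ⊤ := ENNReal.div_ne_top het (by simp)
  have hCa : C * a ≤ e := by
    calc C * a ≤ (C + 1) * a := by gcongr; simp
      _ ≤ e := ENNReal.mul_div_le
  obtain ⟨F0, hF0, hF⟩ := op_small h (e / 2) (ENNReal.div_pos he0.ne' (by norm_num))
  set F := hF0.toFinset with hFdef
  obtain ⟨V, hV, hVs, hVn⟩ := net h.hp F a ha0 hat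
  refine ⟨T '' V, hV.image T, fun lam hlam hlam1 => ?_⟩
  obtain ⟨mu, hmu, hlm⟩ := hlam.2 (min a 1) (lt_min ha0 one_pos)
  have hneg : ∀ f : (Fin d → ℤ) → ℂ, morreyNorm d u p (-f) ≤ morreyNorm d u p f :=
    fun f => morrey_mono d u p h.hp _ _ (by simp)
  have hmu2 : morreyNorm d u p mu ≤ 2 := by
    have e1 : mu = lam + -(lam - mu) := by abel
    rw [e1]
    refine (morrey_add_le d u p h.hp _ _).trans ?_
    calc _ ≤ (1 : ℝ≥0∞) + 1 := by
          gcongr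
          exact (hneg _).trans (hlm.le.trans (min_le_right _ _))
      _ = 2 := by norm_num
  set P : (Fin d → ℤ) → ℂ := fun k => if k ∈ F then mu k else 0 with hP
  set R : (Fin d → ℤ) → ℂ := fun k => if k ∈ F then 0 else mu k with hR
  have hPR : mu = P + R := by
    funext k
    by_cases hk : k ∈ F <;> simp [hP, hR, hk]
  have hPs : (Function.support P).Finite := hmu.subset fun k hk hk' => hk (by simp [hP, hk'])
  have hRs : (Function.support R).Finite := hmu.subset fun k hk hk' => hk (by simp [hR, hk'])
  have hR2 : morreyNorm d u p R ≤ 2 := (morrey_mono d u p h.hp _ _ fun k => by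
    by_cases hk : k ∈ F <;> simp [hR, hk]).trans hmu2
  have hmem : MemMorrey00 d u p (lam - mu) := by
    refine ⟨(hlm.trans_le (min_le_left _ _)).ne_top, fun ε' hε' => ?_⟩
    obtain ⟨nu, hnu, hnu2⟩ := hlam.2 ε' hε'
    refine ⟨nu - mu, (hnu.union hmu).subset (Function.support_sub _ _), ?_⟩
    rwa [sub_sub_sub_cancel_right]
  obtain ⟨v, hvV, hv⟩ := hVn P (fun k hk => by simp [hP, hk]) (fun k => by
    by_cases hk : k ∈ F
    · have h1 := (coord_le_morrey d u p h.hp mu k).trans hmu2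
      have h2 : ‖mu k‖₊ ≤ 2 := by exact_mod_cast h1
      simpa [hP, hk] using (show ‖mu k‖ ≤ 2 from by exact_mod_cast h2)
    · simp [hP, hk])
  refine ⟨T v, ⟨v, hvV, rfl⟩, ?_⟩
  have hvs := hVs v hvV
  have hPvs : (Function.support (P - v)).Finite := (hPs.union hvs).subset (Function.support_sub _ _)
  have hT1 : T lam = T (lam - mu) + T mu := by
    rw [← h.hadd _ _ hmem (h.mem _ hmu), sub_add_cancel]
  have hT2 : T mu = T P + T R := by
    rw [← h.hadd _ _ (h.mem _ hPs) (h.mem _ hRs), ← hPR]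
  have hT3 : T P = T (P - v) + T v := by
    rw [← h.hadd _ _ (h.mem _ hPvs) (h.mem _ hvs), sub_add_cancel]
  have hTe : T lam - T v = T (lam - mu) + T (P - v) + T R := by
    rw [hT1, hT2, hT3]; abel
  have b1 : lpNorm d q (T (lam - mu)) ≤ e := (h.hb _ hmem).trans
    (le_trans (by gcongr; exact hlm.le.trans (min_le_left _ _)) hCa)
  have b2 : lpNorm d q (T (P - v)) ≤ e := (h.hb _ (h.mem _ hPvs)).trans
    (le_trans (by gcongr; exact (morrey_le_lp d u p h.hp h.hpu _).trans hv) hCa)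
  have b3 : lpNorm d q (T R) ≤ e := by
    have hRs' := supp_smul (1 / 2 : ℂ) R hRs
    have hn : (‖(1 / 2 : ℂ)‖₊ : ℝ≥0∞) = 2⁻¹ := by simp
    have h1 := hF ((1 / 2 : ℂ) • R) hRs' (fun k hk => by
        have : k ∈ F := by simpa [hFdef] using hk
        simp [hR, this]) (by
      refine (morrey_smul_le d u p h.hp _ R).trans ?_
      rw [hn]
      calc (2 : ℝ≥0∞)⁻¹ * morreyNorm d u p R ≤ 2⁻¹ * 2 := by gcongr
        _ = 1 := ENNReal.inv_mul_cancel (by norm_num) (by norm_num))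
    have h2 : T R = (2 : ℂ) • T ((1 / 2 : ℂ) • R) := by
      rw [← h.hsmul _ _ (h.mem _ hRs'), smul_smul]; norm_num
    rw [h2, lpNorm_smul d q h.hq]
    calc _ ≤ (‖(2 : ℂ)‖₊ : ℝ≥0∞) * (e / 2) := by gcongr
      _ = 2 * (e / 2) := by simp
      _ = e := ENNReal.mul_div_cancel (by norm_num) (by norm_num)
  rw [hTe]
  refine lt_of_le_of_lt ?_ he
  refine (lpNorm_add_le d q h.hq _ _).trans (add_le_add ?_ b3)
  exact (lpNorm_add_le d q h.hq _ _).trans (add_le_add b1 b2)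

end PittAux

theorem pitt_for_morrey (d : ℕ) (u p q : ℝ) (hp : 1 < p) (hpu : p < u) (hq : 1 ≤ q)
    (T : ((Fin d → ℤ) → ℂ) → (Fin d → ℤ) → ℂ)
    (hadd : ∀ lam mu : (Fin d → ℤ) → ℂ, MemMorrey00 d u p lam → MemMorrey00 d u p mu →
      T (lam + mu) = T lam + T mu)
    (hsmul : ∀ (c : ℂ) (lam : (Fin d → ℤ) → ℂ), MemMorrey00 d u p lam → T (c • lam) = c • T lam)
    (hbdd : ∃ C : ℝ≥0∞, C ≠ ⊤ ∧ ∀ lam : (Fin d → ℤ) → ℂ, MemMorrey00 d u p lam →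
      lpNorm d q (T lam) ≤ C * morreyNorm d u p lam) :
    ∀ ε : ℝ≥0∞, 0 < ε → ∃ Y : Set ((Fin d → ℤ) → ℂ), Y.Finite ∧
      ∀ lam : (Fin d → ℤ) → ℂ, MemMorrey00 d u p lam → morreyNorm d u p lam ≤ 1 →
        ∃ y ∈ Y, lpNorm d q (T lam - y) < ε := by
  obtain ⟨C, hC, hb⟩ := hbdd
  intro ε hε
  exact PittAux.main ⟨hp, hpu, hq, hC, hadd, hsmul, hb⟩ ε hε
end
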